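/- Monotonicity of the generalized r-absolute Schmidt robustness under mixed-unitary (free) operations: if ρ is a density matrix on ℂ^d ⊗ ℂ^d, (p_i)_{i∈I} is a finite family of nonnegative reals with Σ_i p_i = 1, and (U_i)_{i∈I} are unitary (d²)×(d²) matrices, then M_GR(Σ_i p_i · U_i ρ U_i†) ≤ M_GR(ρ). -/

import Mathlib

open Matrix BigOperators
open scoped ComplexOrder

/-- The space of complex matrices acting on `ℂ^d ⊗ ℂ^d`. -/
abbrev MatD (d : ℕ) := Matrix (Fin d × Fin d) (Fin d × Fin d) ℂ

/-- A density matrix on `ℂ^d ⊗ ℂ^d`: positive semidefinite with trace 1. -/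
def IsDensity (d : ℕ) (ρ : MatD d) : Prop :=
  ρ.PosSemidef ∧ ρ.trace = 1

/-- `ρ` has Schmidt number at most `r`: it is a finite convex combination of rank-one
projections onto unit vectors `ψ_k` whose Schmidt rank (the rank of the associated
`d × d` matrix) is at most `r`. -/
def InSchmidt (d r : ℕ) (ρ : MatD d) : Prop :=
  ∃ (n : ℕ) (p : Fin n → ℝ) (ψ : Fin n → (Fin d × Fin d) → ℂ),
    (∀ k, 0 ≤ p k) ∧ (∑ k, p k = 1) ∧
    (∀ k, ∑ x, Complex.normSq (ψ k x) = 1) ∧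
    (∀ k, (Matrix.of (fun i j => ψ k (i, j))).rank ≤ r) ∧
    ρ = ∑ k, (p k : ℂ) • Matrix.vecMulVec (ψ k) (star (ψ k))

/-- `ρ` belongs to `r`-ABSN: it is a density matrix and `U ρ U†` has Schmidt number
at most `r` for every global unitary `U`. -/
def InABSN (d r : ℕ) (ρ : MatD d) : Prop :=
  IsDensity d ρ ∧
  ∀ U ∈ Matrix.unitaryGroup (Fin d × Fin d) ℂ, InSchmidt d r (U * ρ * star U)

/-- The generalized `r`-absolute Schmidt robustness: the infimum (in `[0,∞]`) of
`t ≥ 0` such that `(ρ + t χ)/(1+t) ∈ r`-ABSN for some density matrix `χ`. -/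
noncomputable def MGR (d r : ℕ) (ρ : MatD d) : ENNReal :=
  sInf {s : ENNReal | ∃ t : ℝ, 0 ≤ t ∧ s = ENNReal.ofReal t ∧
    ∃ χ : MatD d, IsDensity d χ ∧ InABSN d r ((1 / (1 + t)) • (ρ + t • χ))}


/-- The set of density matrices of Schmidt number at most `r` is convex. -/
theorem convex_setOf_inSchmidt (d r : ℕ) : Convex ℝ {ρ : MatD d | InSchmidt d r ρ} := by
  rintro x ⟨m, p, ψ, hp, hps, hψ, hψr, rfl⟩ y ⟨n, q, φ, hq, hqs, hφ, hφr, rfl⟩ a b ha hb hab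
  refine ⟨m + n, Fin.append (fun k => a * p k) (fun k => b * q k), Fin.append ψ φ,
    ?_, ?_, ?_, ?_, ?_⟩
  · intro k
    refine Fin.addCases (fun k => ?_) (fun k => ?_) k
    · simpa using mul_nonneg ha (hp k)
    · simpa using mul_nonneg hb (hq k)
  · simp [Fin.sum_univ_add, ← Finset.mul_sum, hps, hqs, hab]
  · intro k
    refine Fin.addCases (fun k => ?_) (fun k => ?_) k
    · simpa using hψ k
    · simpa using hφ k
  · intro k
    refine Fin.addCases (fun k => ?_) (fun k => ?_) k
    · simpa using hψr k
    · simpa using hφr k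
  · simp only [Fin.sum_univ_add, Fin.append_left, Fin.append_right, Finset.smul_sum,
      mul_smul, Complex.coe_smul]

/-- Mixed-unitary channels map density matrices to density matrices. -/
theorem IsDensity.mixed_unitary {d : ℕ} {ρ : MatD d} (hρ : IsDensity d ρ)
    {ι : Type} [Fintype ι] {p : ι → ℝ} (hp : ∀ i, 0 ≤ p i) (hsum : ∑ i, p i = 1)
    {U : ι → MatD d} (hU : ∀ i, U i ∈ Matrix.unitaryGroup (Fin d × Fin d) ℂ) :
    IsDensity d (∑ i, p i • (U i * ρ * star (U i))) := by
  refine ⟨Matrix.posSemidef_sum _ fun i _ => ?_, ?_⟩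
  · exact (hρ.1.mul_mul_conjTranspose_same (U i)).smul (hp i)
  · have h (i : ι) : (U i * ρ * star (U i)).trace = 1 := by
      rw [Matrix.trace_mul_comm, ← mul_assoc, Matrix.mem_unitaryGroup_iff'.1 (hU i), one_mul, hρ.2]
    simp only [Matrix.trace_sum, Matrix.trace_smul, h, ← Finset.sum_smul, hsum, one_smul]

/-- Mixed-unitary channels preserve `r`-ABSN. -/
theorem InABSN.mixed_unitary {d r : ℕ} {ρ : MatD d} (hρ : InABSN d r ρ)
    {ι : Type} [Fintype ι] {p : ι → ℝ} (hp : ∀ i, 0 ≤ p i) (hsum : ∑ i, p i = 1)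
    {U : ι → MatD d} (hU : ∀ i, U i ∈ Matrix.unitaryGroup (Fin d × Fin d) ℂ) :
    InABSN d r (∑ i, p i • (U i * ρ * star (U i))) := by
  refine ⟨hρ.1.mixed_unitary hp hsum hU, fun V hV => ?_⟩
  have h : V * (∑ i, p i • (U i * ρ * star (U i))) * star V
      = ∑ i, p i • (V * U i * ρ * star (V * U i)) := by
    simp only [Finset.mul_sum, Finset.sum_mul, mul_smul_comm, smul_mul_assoc, star_mul, mul_assoc]
  rw [h]
  exact (convex_setOf_inSchmidt d r).sum_mem (fun i _ => hp i) hsum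
    fun i _ => hρ.2 _ (mul_mem hV (hU i))

/-- monotonicity of the generalized `r`-absolute Schmidt robustness
under mixed-unitary (free) operations. -/
theorem MGR_monotone_mixed_unitary (d r : ℕ) (hd : 1 ≤ d) (hr : 1 ≤ r)
    (ρ : MatD d) (hρ : IsDensity d ρ)
    (ι : Type) [Fintype ι] (p : ι → ℝ) (hp : ∀ i, 0 ≤ p i) (hsum : ∑ i, p i = 1)
    (U : ι → MatD d) (hU : ∀ i, U i ∈ Matrix.unitaryGroup (Fin d × Fin d) ℂ) :
    MGR d r (∑ i, p i • (U i * ρ * star (U i))) ≤ MGR d r ρ := by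
  refine sInf_le_sInf ?_
  rintro _ ⟨t, ht, rfl, χ, hχ, hABSN⟩
  refine ⟨t, ht, rfl, ∑ i, p i • (U i * χ * star (U i)), hχ.mixed_unitary hp hsum hU, ?_⟩
  have h : (1 / (1 + t)) • (∑ i, p i • (U i * ρ * star (U i))
        + t • ∑ i, p i • (U i * χ * star (U i)))
      = ∑ i, p i • (U i * ((1 / (1 + t)) • (ρ + t • χ)) * star (U i)) := by
    simp only [Finset.smul_sum, ← Finset.sum_add_distrib, mul_smul_comm, smul_mul_assoc,
      mul_add, add_mul, smul_add, smul_comm (p _)]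
  rw [h]
  exact hABSN.mixed_unitary hp hsum hU
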